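/- Let C be an n×n real symmetric matrix and 1 ≤ k ≤ n. Then the sum of the k largest eigenvalues of C equals the maximum of tr(CP) over all n×n real symmetric projection matrices P of rank k (P² = P, Pᵀ = P, rank P = k). -/

import Mathlib

open Finset

/-- Decreasing rearrangement of a vector in ℝⁿ. -/
noncomputable def dsort {n : ℕ} (v : Fin n → ℝ) : Fin n → ℝ :=
  fun i => - ((fun j => - v j) ∘ Tuple.sort (fun j => - v j)) i

theorem dsort_apply {n : ℕ} (v : Fin n → ℝ) (i : Fin n) :
    dsort v i = v (Tuple.sort (fun j => - v j) i) := by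
  simp [dsort]

theorem dsort_antitone {n : ℕ} (v : Fin n → ℝ) : Antitone (dsort v) :=
  fun _ _ h => neg_le_neg (Tuple.monotone_sort (fun j => - v j) h)

theorem Matrix.trace_eq_rank_of_mul_self {n : ℕ} {P : Matrix (Fin n) (Fin n) ℝ}
    (hP : P * P = P) : P.trace = P.rank := by
  have h : IsIdempotentElem P.toLin' := by
    rw [IsIdempotentElem, Module.End.mul_eq_comp, ← Matrix.toLin'_mul, hP]
  have ht := (LinearMap.IsIdempotentElem.isProj_range _ h).trace
  rwa [Matrix.trace_toLin'_eq] at ht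

theorem sum_ite_val_lt {n k : ℕ} (hkn : k ≤ n) :
    (∑ i : Fin n, if (i : ℕ) < k then (1 : ℝ) else 0) = k := by
  simp [Fin.card_filter_val_lt, hkn]

/-- A weighted sum of a decreasing vector, with weights in `[0, 1]` of total mass `k`, is at most
the sum of the first `k` entries. -/
theorem sum_mul_le_sum_ite_of_antitone {n k : ℕ} (hk : 1 ≤ k) (hkn : k ≤ n) {d w : Fin n → ℝ}
    (hd : Antitone d) (hw0 : ∀ i, 0 ≤ w i) (hw1 : ∀ i, w i ≤ 1) (hw : ∑ i, w i = k) :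
    ∑ i, d i * w i ≤ ∑ i : Fin n, if (i : ℕ) < k then d i else 0 := by
  let c := d ⟨k - 1, by omega⟩
  have key : ∀ i : Fin n, d i * w i ≤
      (if (i : ℕ) < k then d i else 0) + c * (w i - if (i : ℕ) < k then 1 else 0) := by
    intro i
    split_ifs with h
    · have : c ≤ d i := hd (Fin.le_def.2 (by simp; omega))
      nlinarith [hw1 i]
    · have : d i ≤ c := hd (Fin.le_def.2 (by simp; omega))
      nlinarith [hw0 i]
  refine (Finset.sum_le_sum fun i _ => key i).trans_eq ?_
  rw [Finset.sum_add_distrib, ← Finset.mul_sum, Finset.sum_sub_distrib, hw, sum_ite_val_lt hkn]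
  ring

theorem Matrix.diag_mem_Icc_of_mul_self {n : ℕ} {Q : Matrix (Fin n) (Fin n) ℝ}
    (hQ : Q * Q = Q) (hQT : Q.transpose = Q) (i : Fin n) : Q i i ∈ Set.Icc (0 : ℝ) 1 := by
  have h : ∑ j, Q i j ^ 2 = Q i i := by
    conv_rhs => rw [← hQ, Matrix.mul_apply]
    refine Finset.sum_congr rfl fun j _ => ?_
    rw [sq, ← Matrix.transpose_apply Q i j, hQT]
  have h0 : 0 ≤ Q i i := h ▸ Finset.sum_nonneg fun j _ => sq_nonneg _
  have h1 : Q i i ^ 2 ≤ Q i i := h ▸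
    Finset.single_le_sum (f := fun j => Q i j ^ 2) (fun j _ => sq_nonneg _) (Finset.mem_univ i)
  exact ⟨h0, by nlinarith⟩

theorem Matrix.IsHermitian.exists_orthogonal_diagonalization {n : ℕ}
    {C : Matrix (Fin n) (Fin n) ℝ} (hC : C.IsHermitian) :
    ∃ U : Matrix (Fin n) (Fin n) ℝ, U.transpose * U = 1 ∧ U * U.transpose = 1 ∧
      C = U * Matrix.diagonal hC.eigenvalues * U.transpose := by
  refine ⟨hC.eigenvectorUnitary, ?_, ?_, ?_⟩
  · exact Unitary.coe_star_mul_self hC.eigenvectorUnitary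
  · exact Unitary.coe_mul_star_self hC.eigenvectorUnitary
  · exact hC.spectral_theorem

theorem stmt12 {n : ℕ} (C : Matrix (Fin n) (Fin n) ℝ) (hC : C.IsHermitian)
    (k : ℕ) (hk1 : 1 ≤ k) (hkn : k ≤ n) :
    IsGreatest
      {r : ℝ | ∃ P : Matrix (Fin n) (Fin n) ℝ,
        P * P = P ∧ P.transpose = P ∧ P.rank = k ∧ r = Matrix.trace (C * P)}
      (∑ i : Fin n, if (i : ℕ) < k then dsort hC.eigenvalues i else 0) := by
  obtain ⟨U, hU, hU', hCU⟩ := hC.exists_orthogonal_diagonalization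
  set v := hC.eigenvalues
  set σ := Tuple.sort fun j => - v j with hσ
  have trace_mul (Q : Matrix (Fin n) (Fin n) ℝ) :
      (Matrix.diagonal v * Q).trace = ∑ i, dsort v i * Q (σ i) (σ i) := by
    simp only [dsort_apply, ← hσ]
    rw [Equiv.sum_comp σ fun i => v i * Q i i]
    simp [Matrix.trace, Matrix.diagonal_mul]
  constructor
  · let w : Fin n → ℝ := fun i => if (σ.symm i : ℕ) < k then 1 else 0
    have hw : Matrix.diagonal w * Matrix.diagonal w = Matrix.diagonal w := by
      rw [Matrix.diagonal_mul_diagonal]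
      congr 1
      ext i
      simp [w]
    have hP : (U * Matrix.diagonal w * U.transpose) * (U * Matrix.diagonal w * U.transpose) =
        U * Matrix.diagonal w * U.transpose := by
      calc _ = U * Matrix.diagonal w * (U.transpose * U) * Matrix.diagonal w * U.transpose := by
            simp only [Matrix.mul_assoc]
        _ = U * (Matrix.diagonal w * Matrix.diagonal w) * U.transpose := by
            rw [hU, Matrix.mul_one, Matrix.mul_assoc U]
        _ = _ := by rw [hw]
    refine ⟨U * Matrix.diagonal w * U.transpose, hP, ?_, ?_, ?_⟩
    · simp [Matrix.transpose_mul, Matrix.mul_assoc]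
    · have h := Matrix.trace_eq_rank_of_mul_self hP
      rw [Matrix.trace_mul_comm, ← Matrix.mul_assoc, hU, Matrix.one_mul, Matrix.trace_diagonal,
        ← Equiv.sum_comp σ w] at h
      simp only [w, Equiv.symm_apply_apply] at h
      rw [sum_ite_val_lt hkn] at h
      exact Nat.cast_injective h.symm
    · have h : C * (U * Matrix.diagonal w * U.transpose) =
          U * (Matrix.diagonal v * Matrix.diagonal w * U.transpose) := by
        calc _ = U * Matrix.diagonal v * (U.transpose * U) * Matrix.diagonal w * U.transpose := by
              conv_lhs => rw [hCU]
              simp only [Matrix.mul_assoc]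
          _ = _ := by rw [hU, Matrix.mul_one]; simp only [Matrix.mul_assoc]
      rw [h, Matrix.trace_mul_comm, Matrix.mul_assoc, hU, Matrix.mul_one, trace_mul]
      simp [w]
  · rintro r ⟨P, hP, hPT, hPk, rfl⟩
    let Q := U.transpose * P * U
    have hQ : Q * Q = Q := by
      calc _ = U.transpose * P * (U * U.transpose) * P * U := by
            simp only [Q, Matrix.mul_assoc]
        _ = U.transpose * (P * P) * U := by
            rw [hU', Matrix.mul_one, Matrix.mul_assoc U.transpose]
        _ = Q := by rw [hP]
    have hQT : Q.transpose = Q := by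
      simp [Q, Matrix.transpose_mul, hPT, Matrix.mul_assoc]
    have hQk : Q.trace = k := by
      rw [Matrix.trace_mul_comm, ← Matrix.mul_assoc, hU', Matrix.one_mul,
        Matrix.trace_eq_rank_of_mul_self hP, hPk]
    have hCP : (C * P).trace = (Matrix.diagonal v * Q).trace := by
      conv_lhs => rw [hCU]
      rw [Matrix.mul_assoc, Matrix.mul_assoc, Matrix.trace_mul_comm]
      simp only [Q, Matrix.mul_assoc]
    rw [hCP, trace_mul]
    have hQI := Matrix.diag_mem_Icc_of_mul_self hQ hQT
    exact sum_mul_le_sum_ite_of_antitone hk1 hkn (dsort_antitone v) (fun i => (hQI (σ i)).1)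
      (fun i => (hQI (σ i)).2) ((Equiv.sum_comp σ fun i => Q i i).trans hQk)
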